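/- Let (v₁, v₂, v₃) be an orthonormal basis of ℝ³, let 0 ≤ λ₁ < λ₂ < λ₃, and set M := λ₁v₁v₁ᵀ + λ₂v₂v₂ᵀ + λ₃v₃v₃ᵀ. Let u ∈ ℝ³ be a unit vector such that (λ₁ + λ₃) − ⟨u,v₁⟩²(λ₁ + λ₂) − ⟨u,v₃⟩²(λ₂ + λ₃) > 0 and (λ₁ + λ₂) − ⟨u,v₁⟩²(λ₁ + λ₃) − ⟨u,v₂⟩²(λ₂ + λ₃) > 0. Then for every unit vector v ∈ ℝ³ that is an eigenvector of M and every ψ ∈ (0, 2π), tr(M(I − R_a(π,v)·R_a(ψ,u))) < tr(M(I − R_a(π,v))). -/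

import Mathlib

open Matrix Real

noncomputable section

/-- The hat map: u^∧ y = u × y. -/
def hat (u : Fin 3 → ℝ) : Matrix (Fin 3) (Fin 3) ℝ :=
  !![0, -u 2, u 1; u 2, 0, -u 0; -u 1, u 0, 0]

/-- The Rodrigues rotation R_a(θ, u) = I + sin θ · u^∧ + (1 − cos θ)·(u^∧)². -/
def Ra (θ : ℝ) (u : Fin 3 → ℝ) : Matrix (Fin 3) (Fin 3) ℝ :=
  1 + Real.sin θ • hat u + (1 - Real.cos θ) • (hat u * hat u)

theorem hat_mul_hat (u : Fin 3 → ℝ) :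
    hat u * hat u = vecMulVec u u - (u ⬝ᵥ u) • (1 : Matrix (Fin 3) (Fin 3) ℝ) := by
  ext i j
  fin_cases i <;> fin_cases j <;>
    simp [hat, Matrix.mul_apply, Fin.sum_univ_three, vecMulVec_apply, dotProduct] <;> ring

theorem trace_mul_hat {A : Matrix (Fin 3) (Fin 3) ℝ} (hA : A.IsSymm) (u : Fin 3 → ℝ) :
    (A * hat u).trace = 0 := by
  simp only [hat, Matrix.trace, Matrix.diag_apply, Matrix.mul_apply, Fin.sum_univ_three, of_apply,
    cons_val]
  rw [hA.apply 0 1, hA.apply 0 2, hA.apply 1 2]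
  ring

theorem trace_mul_Ra_sub_one {A : Matrix (Fin 3) (Fin 3) ℝ} (hA : A.IsSymm) (ψ : ℝ)
    {u : Fin 3 → ℝ} (hu : u ⬝ᵥ u = 1) :
    (A * (Ra ψ u - 1)).trace = (1 - Real.cos ψ) * (u ⬝ᵥ A *ᵥ u - A.trace) := by
  have h : Ra ψ u - 1 = Real.sin ψ • hat u + (1 - Real.cos ψ) • (vecMulVec u u - 1) := by
    rw [Ra, hat_mul_hat, hu, one_smul]
    abel
  rw [h, mul_add, mul_smul_comm, mul_smul_comm, mul_sub, mul_one, trace_add, trace_smul,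
    trace_smul, trace_sub, trace_mul_hat hA, mul_vecMulVec, trace_vecMulVec, dotProduct_comm]
  simp

theorem mul_Ra_pi {M : Matrix (Fin 3) (Fin 3) ℝ} {v : Fin 3 → ℝ} (hv : v ⬝ᵥ v = 1) {μ : ℝ}
    (hMv : M *ᵥ v = μ • v) : M * Ra π v = (2 * μ) • vecMulVec v v - M := by
  have h : Ra π v = (2 : ℝ) • vecMulVec v v - 1 := by
    rw [Ra, hat_mul_hat, hv, Real.sin_pi, Real.cos_pi]
    module
  rw [h, mul_sub, mul_one, mul_smul_comm, mul_vecMulVec, hMv, smul_vecMulVec, smul_smul]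

/-- Warping a critical rotation `Ra π v` changes the potential by a multiple of `1 - cos ψ`. -/
theorem trace_potential_sub {M : Matrix (Fin 3) (Fin 3) ℝ} (hM : M.IsSymm)
    {u v : Fin 3 → ℝ} (hu : u ⬝ᵥ u = 1) (hv : v ⬝ᵥ v = 1) {μ : ℝ} (hMv : M *ᵥ v = μ • v)
    (ψ : ℝ) :
    (M * (1 - Ra π v)).trace - (M * (1 - Ra π v * Ra ψ u)).trace =
      (1 - Real.cos ψ) * (M.trace - 2 * μ + 2 * μ * (u ⬝ᵥ v) ^ 2 - u ⬝ᵥ M *ᵥ u) := by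
  have hA : ((2 * μ) • vecMulVec v v - M).IsSymm := by
    simp [Matrix.IsSymm, hM.eq, transpose_vecMulVec]
  have h : M * (1 - Ra π v) - M * (1 - Ra π v * Ra ψ u) = M * Ra π v * (Ra ψ u - 1) := by
    noncomm_ring
  rw [← trace_sub, h, mul_Ra_pi hv hMv, trace_mul_Ra_sub_one hA ψ hu]
  simp only [sub_mulVec, smul_mulVec, vecMulVec_mulVec, dotProduct_sub, dotProduct_smul,
    trace_sub, trace_smul, trace_vecMulVec, hv, smul_eq_mul,
    op_smul_eq_smul, dotProduct_comm v u]
  ring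

theorem sum_vecMulVec_eq_one_of_orthonormal {v₁ v₂ v₃ : Fin 3 → ℝ}
    (h11 : v₁ ⬝ᵥ v₁ = 1) (h22 : v₂ ⬝ᵥ v₂ = 1) (h33 : v₃ ⬝ᵥ v₃ = 1)
    (h12 : v₁ ⬝ᵥ v₂ = 0) (h13 : v₁ ⬝ᵥ v₃ = 0) (h23 : v₂ ⬝ᵥ v₃ = 0) :
    vecMulVec v₁ v₁ + vecMulVec v₂ v₂ + vecMulVec v₃ v₃ = 1 := by
  have h : (of ![v₁, v₂, v₃]) * (of ![v₁, v₂, v₃])ᵀ = 1 := by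
    ext i j
    change ![v₁, v₂, v₃] i ⬝ᵥ ![v₁, v₂, v₃] j = _
    fin_cases i <;> fin_cases j <;>
      simp [h11, h22, h33, h12, h13, h23, dotProduct_comm v₂ v₁, dotProduct_comm v₃ v₁,
        dotProduct_comm v₃ v₂]
  rw [← mul_eq_one_comm.mp h]
  ext i j
  simp [Matrix.mul_apply, Fin.sum_univ_three, vecMulVec_apply]

theorem dotProduct_eq_sum_of_orthonormal {v₁ v₂ v₃ : Fin 3 → ℝ}
    (h11 : v₁ ⬝ᵥ v₁ = 1) (h22 : v₂ ⬝ᵥ v₂ = 1) (h33 : v₃ ⬝ᵥ v₃ = 1)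
    (h12 : v₁ ⬝ᵥ v₂ = 0) (h13 : v₁ ⬝ᵥ v₃ = 0) (h23 : v₂ ⬝ᵥ v₃ = 0) (x y : Fin 3 → ℝ) :
    x ⬝ᵥ y = (x ⬝ᵥ v₁) * (y ⬝ᵥ v₁) + (x ⬝ᵥ v₂) * (y ⬝ᵥ v₂) + (x ⬝ᵥ v₃) * (y ⬝ᵥ v₃) := by
  have h := congrArg (fun A => x ⬝ᵥ A *ᵥ y)
    (sum_vecMulVec_eq_one_of_orthonormal h11 h22 h33 h12 h13 h23)
  simp only [add_mulVec, vecMulVec_mulVec, dotProduct_add, dotProduct_smul, one_mulVec,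
    op_smul_eq_smul, smul_eq_mul, dotProduct_comm _ y] at h
  linarith [dotProduct_comm x y]

/-- Synergy condition (Theorem 1, case 5): for M with distinct eigenvalues
0 ≤ λ₁ < λ₂ < λ₃ and a warping direction u with Δ(v₂,u) > 0 and
Δ(v₃,u) > 0, the warped potential strictly decreases at every unwanted
critical point. -/
theorem synergy_case_distinct_eigenvalues
    (v₁ v₂ v₃ : Fin 3 → ℝ)
    (h11 : v₁ ⬝ᵥ v₁ = 1) (h22 : v₂ ⬝ᵥ v₂ = 1) (h33 : v₃ ⬝ᵥ v₃ = 1)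
    (h12 : v₁ ⬝ᵥ v₂ = 0) (h13 : v₁ ⬝ᵥ v₃ = 0) (h23 : v₂ ⬝ᵥ v₃ = 0)
    (l₁ l₂ l₃ : ℝ) (hl₁ : 0 ≤ l₁) (h12l : l₁ < l₂) (h23l : l₂ < l₃)
    (M : Matrix (Fin 3) (Fin 3) ℝ)
    (hMdef : M = l₁ • vecMulVec v₁ v₁ + l₂ • vecMulVec v₂ v₂ + l₃ • vecMulVec v₃ v₃)
    (u : Fin 3 → ℝ) (hu : u ⬝ᵥ u = 1)
    (hΔ2 : 0 < (l₁ + l₃) - (u ⬝ᵥ v₁)^2 * (l₁ + l₂) - (u ⬝ᵥ v₃)^2 * (l₂ + l₃))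
    (hΔ3 : 0 < (l₁ + l₂) - (u ⬝ᵥ v₁)^2 * (l₁ + l₃) - (u ⬝ᵥ v₂)^2 * (l₂ + l₃)) :
    ∀ v : Fin 3 → ℝ, v ⬝ᵥ v = 1 → (∃ μ : ℝ, M *ᵥ v = μ • v) →
      ∀ ψ ∈ Set.Ioo (0 : ℝ) (2 * π),
        (M * (1 - Ra π v * Ra ψ u)).trace < (M * (1 - Ra π v)).trace := by
  intro v hv ⟨μ, hMv⟩ ψ hψ
  have expand := dotProduct_eq_sum_of_orthonormal h11 h22 h33 h12 h13 h23
  have hM : M.IsSymm := by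
    simp [hMdef, Matrix.IsSymm, transpose_vecMulVec]
  have htr : M.trace = l₁ + l₂ + l₃ := by
    simp [hMdef, trace_vecMulVec, h11, h22, h33]
  have hMdot : ∀ x y : Fin 3 → ℝ, x ⬝ᵥ M *ᵥ y = l₁ * (x ⬝ᵥ v₁) * (y ⬝ᵥ v₁) +
      l₂ * (x ⬝ᵥ v₂) * (y ⬝ᵥ v₂) + l₃ * (x ⬝ᵥ v₃) * (y ⬝ᵥ v₃) := by
    intro x y
    simp only [hMdef, add_mulVec, smul_mulVec, vecMulVec_mulVec, dotProduct_add, dotProduct_smul,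
      op_smul_eq_smul, smul_eq_mul, dotProduct_comm _ y]
    ring
  have hcos : 0 < 1 - Real.cos ψ := by
    have hne : Real.cos ψ ≠ 1 := fun h =>
      hψ.1.ne' ((Real.cos_eq_one_iff_of_lt_of_lt (by linarith [hψ.1, Real.pi_pos]) hψ.2).mp h)
    linarith [lt_of_le_of_ne (Real.cos_le_one ψ) hne]
  have heig : ∀ w, w ⬝ᵥ M *ᵥ v = μ * (v ⬝ᵥ w) := fun w => by
    rw [hMv, dotProduct_smul, smul_eq_mul, dotProduct_comm]
  have e₁ : (l₁ - μ) * (v ⬝ᵥ v₁) = 0 := by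
    have := heig v₁
    rw [hMdot, h11, h12, h13] at this
    linarith
  have e₂ : (l₂ - μ) * (v ⬝ᵥ v₂) = 0 := by
    have := heig v₂
    rw [hMdot, dotProduct_comm v₂ v₁, h12, h22, h23] at this
    linarith
  have e₃ : (l₃ - μ) * (v ⬝ᵥ v₃) = 0 := by
    have := heig v₃
    rw [hMdot, dotProduct_comm v₃ v₁, dotProduct_comm v₃ v₂, h13, h23, h33] at this
    linarith
  rw [← sub_pos, trace_potential_sub hM hu hv hMv]
  refine mul_pos hcos ?_
  rw [htr, hMdot, expand u v]
  rw [expand v v] at hv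
  rw [expand u u] at hu
  generalize u ⬝ᵥ v₁ = a at *
  generalize u ⬝ᵥ v₂ = b at *
  generalize u ⬝ᵥ v₃ = c at *
  generalize v ⬝ᵥ v₁ = x at *
  generalize v ⬝ᵥ v₂ = y at *
  generalize v ⬝ᵥ v₃ = z at *
  rcases mul_eq_zero.mp e₁ with h₁ | rfl
  · obtain rfl : μ = l₁ := by linarith
    obtain rfl : y = 0 := (mul_eq_zero.mp e₂).resolve_left (by linarith)
    obtain rfl : z = 0 := (mul_eq_zero.mp e₃).resolve_left (by linarith)
    have key : 0 < a * a * (l₂ + l₃) + b * b * (l₃ - μ) + c * c * (l₂ - μ) := by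
      have ha := mul_nonneg (mul_self_nonneg a) (by linarith : 0 ≤ l₂ + l₃ - (l₂ - μ))
      have hb := mul_nonneg (mul_self_nonneg b) (by linarith : 0 ≤ l₃ - μ - (l₂ - μ))
      linear_combination ha + hb + h12l - (l₂ - μ) * hu
    linear_combination key - 2 * μ * a ^ 2 * hv + (l₂ + l₃ - μ) * hu
  rcases mul_eq_zero.mp e₂ with h₂ | rfl
  · obtain rfl : μ = l₂ := by linarith
    obtain rfl : z = 0 := (mul_eq_zero.mp e₃).resolve_left (by linarith)
    linear_combination hΔ2 - 2 * μ * b ^ 2 * hv - μ * hu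
  rcases mul_eq_zero.mp e₃ with h₃ | rfl
  · obtain rfl : μ = l₃ := by linarith
    linear_combination hΔ3 - 2 * μ * c ^ 2 * hv - μ * hu
  · norm_num at hv

end
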